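/- For every q ∈ (1,2] there exists a constant c_q > 0, depending only on q and s, such that for every summable f : ℤ → ℝ one has ‖G̃(f)‖_q ≤ c_q ‖f‖_q, where G̃(f)(x) = (∫₀^∞ |∇̃(P_t f)|²(x) dt)^{1/2}. -/

import Mathlib

open MeasureTheory Real

/-- The kernel `K_s` of the fractional discrete Laplacian on `ℤ`. -/
noncomputable def Ker (s : ℝ) (m : ℤ) : ℝ :=
  if m = 0 then 0
  else ((4 : ℝ) ^ s * Real.Gamma (1 / 2 + s) / (Real.sqrt Real.pi * |Real.Gamma (-s)|)) *
    (Real.Gamma ((m.natAbs : ℝ) - s) / Real.Gamma ((m.natAbs : ℝ) + 1 + s))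

/-- The fractional discrete Laplacian `L = (-Δ)^s` acting pointwise. -/
noncomputable def Lop (s : ℝ) (f : ℤ → ℝ) : ℤ → ℝ :=
  fun x => ∑' y : ℤ, (f x - f y) * Ker s (x - y)

/-- The heat semigroup `P_t = exp (-t L)`, given by the exponential series of the
bounded operator `-tL` (evaluated pointwise). -/
noncomputable def heat (s t : ℝ) (f : ℤ → ℝ) : ℤ → ℝ :=
  fun x => ∑' n : ℕ, ((-t) ^ n / (n.factorial : ℝ)) * ((Lop s)^[n] f x)

/-- The squared modulus of the gradient, `|∇f|²(x) = Σ_y K_s(y-x) (f x - f y)²`. -/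
noncomputable def gradSq (s : ℝ) (f : ℤ → ℝ) (x : ℤ) : ℝ :=
  ∑' y : ℤ, Ker s (y - x) * (f x - f y) ^ 2

/-- The squared modulus of the modified gradient,
`|∇̃f|²(x) = Σ_{y : |f y| < |f x|} K_s(y-x) (f x - f y)²`. -/
noncomputable def mgradSq (s : ℝ) (f : ℤ → ℝ) (x : ℤ) : ℝ :=
  ∑' y : {y : ℤ // |f y| < |f x|}, Ker s ((y : ℤ) - x) * (f x - f (y : ℤ)) ^ 2

/-- The `ℓ^q` norm on `ℤ` with counting measure (for finite `q`). -/
noncomputable def lqNorm (q : ℝ) (f : ℤ → ℝ) : ℝ :=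
  (∑' x : ℤ, |f x| ^ q) ^ (1 / q)

open scoped ENNReal

/-! ### Symmetric decreasing kernels and convolution on `ℤ` -/

/-- Convolution of extended nonnegative functions on `ℤ`. -/
noncomputable def zconv (g F : ℤ → ℝ≥0∞) (x : ℤ) : ℝ≥0∞ :=
  ∑' y : ℤ, g (x - y) * F y

/-- A function on `ℤ` which is a nonincreasing function of `|x|`. -/
def SymmDecr (g : ℤ → ℝ≥0∞) : Prop :=
  ∀ x y : ℤ, x.natAbs ≤ y.natAbs → g y ≤ g x

/-- The centred Hardy–Littlewood maximal function on `ℤ`. -/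
noncomputable def hlMax (F : ℤ → ℝ≥0∞) (x : ℤ) : ℝ≥0∞ :=
  ⨆ n : ℕ, (∑ m ∈ Finset.Icc (-(n : ℤ)) n, F (x - m)) / (2 * n + 1)

theorem ENNReal.mul_add_mul_le_of_le {a a' b b' : ℝ≥0∞} (ha : a ≤ a') (hb : b ≤ b') :
    a' * b + a * b' ≤ a * b + a' * b' := by
  obtain ⟨d, rfl⟩ := exists_add_of_le ha
  calc (a + d) * b + a * b' = a * b + a * b' + d * b := by ring
    _ ≤ a * b + a * b' + d * b' := by gcongr
    _ = a * b + (a + d) * b' := by ring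

theorem zconv_assoc (g h F : ℤ → ℝ≥0∞) (x : ℤ) :
    zconv g (zconv h F) x = zconv (zconv g h) F x := by
  unfold zconv
  simp_rw [← ENNReal.tsum_mul_left, ← ENNReal.tsum_mul_right]
  rw [ENNReal.tsum_comm]
  refine tsum_congr fun z => ?_
  rw [← (Equiv.addRight z).tsum_eq]
  refine tsum_congr fun y => ?_
  simp only [Equiv.coe_addRight]
  rw [show x - (y + z) = x - z - y by ring, show y + z - z = y by ring, mul_assoc]

theorem tsum_zconv (g h : ℤ → ℝ≥0∞) :
    ∑' x, zconv g h x = (∑' x, g x) * ∑' x, h x := by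
  unfold zconv
  rw [ENNReal.tsum_comm, ← ENNReal.tsum_mul_left]
  refine tsum_congr fun y => ?_
  rw [ENNReal.tsum_mul_right]
  congr 1
  exact (Equiv.subRight y).tsum_eq g

theorem SymmDecr.zconv {g h : ℤ → ℝ≥0∞} (hg : SymmDecr g) (hh : SymmDecr h) :
    SymmDecr (zconv g h) := by
  intro x y hxy
  have key : ∀ z : ℤ, g (y - z) * h z + g (x - z) * h (x + y - z) ≤
      g (x - z) * h z + g (y - z) * h (x + y - z) := by
    intro z
    have : ((x - z).natAbs ≤ (y - z).natAbs ∧ z.natAbs ≤ (x + y - z).natAbs) ∨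
        ((y - z).natAbs ≤ (x - z).natAbs ∧ (x + y - z).natAbs ≤ z.natAbs) := by omega
    rcases this with ⟨h1, h2⟩ | ⟨h1, h2⟩
    · have := ENNReal.mul_add_mul_le_of_le (hg _ _ h1) (hh _ _ h2)
      rwa [add_comm (g (y - z) * h (x + y - z)), add_comm (g (x - z) * h (x + y - z))] at this
    · exact ENNReal.mul_add_mul_le_of_le (hg _ _ h1) (hh _ _ h2)
  have refl1 : ∑' z, g (x - z) * h (x + y - z) = _root_.zconv g h y := by
    unfold _root_.zconv
    rw [← (Equiv.subLeft (x + y)).tsum_eq]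
    refine tsum_congr fun z => ?_
    simp only [Equiv.subLeft_apply]
    rw [show x - (x + y - z) = -(y - z) by ring, show x + y - (x + y - z) = z by ring]
    congr 1
    exact le_antisymm (hg _ _ (by omega)) (hg _ _ (by omega))
  have refl2 : ∑' z, g (y - z) * h (x + y - z) = _root_.zconv g h x := by
    unfold _root_.zconv
    rw [← (Equiv.subLeft (x + y)).tsum_eq]
    refine tsum_congr fun z => ?_
    simp only [Equiv.subLeft_apply]
    rw [show y - (x + y - z) = -(x - z) by ring, show x + y - (x + y - z) = z by ring]
    congr 1
    exact le_antisymm (hg _ _ (by omega)) (hg _ _ (by omega))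
  have := ENNReal.tsum_le_tsum key
  rw [ENNReal.tsum_add, ENNReal.tsum_add, refl1, refl2] at this
  change _root_.zconv g h y + _root_.zconv g h y ≤ _root_.zconv g h x + _root_.zconv g h x at this
  rw [← two_mul, ← two_mul] at this
  exact (ENNReal.mul_le_mul_iff_right (by simp) (by simp)).1 this

theorem sum_Icc_le_hlMax (F : ℤ → ℝ≥0∞) (x : ℤ) (n : ℕ) :
    ∑ m ∈ Finset.Icc (-(n : ℤ)) n, F (x - m) ≤ (2 * n + 1) * hlMax F x := by
  rw [mul_comm, ← ENNReal.div_le_iff (by simp) (by finiteness)]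
  exact le_iSup (fun n : ℕ => (∑ m ∈ Finset.Icc (-(n : ℤ)) n, F (x - m)) / (2 * n + 1)) n

theorem SymmDecr.sum_Icc_mul_le (F : ℤ → ℝ≥0∞) (x : ℤ) (n : ℕ) :
    ∀ {g : ℤ → ℝ≥0∞}, SymmDecr g →
    ∑ m ∈ Finset.Icc (-(n : ℤ)) n, g m * F (x - m) ≤
      (∑ m ∈ Finset.Icc (-(n : ℤ)) n, g m) * hlMax F x := by
  induction n with
  | zero =>
    intro g _
    have := sum_Icc_le_hlMax F x 0
    simp only [Nat.cast_zero, neg_zero, Finset.Icc_self, Finset.sum_singleton, mul_zero, zero_add,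
      one_mul] at this ⊢
    gcongr
  | succ n ih =>
    intro g hg
    set b := g ((n + 1 : ℕ) : ℤ) with hb
    have hg' : SymmDecr fun m => g m - b := fun x y hxy => tsub_le_tsub_right (hg x y hxy) b
    have hsub : Finset.Icc (-(n : ℤ)) n ⊆ Finset.Icc (-((n + 1 : ℕ) : ℤ)) (n + 1 : ℕ) :=
      Finset.Icc_subset_Icc (by push_cast; omega) (by push_cast; omega)
    have hvan : ∀ m ∈ Finset.Icc (-((n + 1 : ℕ) : ℤ)) (n + 1 : ℕ),
        m ∉ Finset.Icc (-(n : ℤ)) n → g m - b = 0 := by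
      intro m hm hm'
      rw [Finset.mem_Icc] at hm hm'
      exact tsub_eq_zero_of_le (hg _ _ (by omega))
    have hdec : ∀ m ∈ Finset.Icc (-((n + 1 : ℕ) : ℤ)) (n + 1 : ℕ), g m = (g m - b) + b := by
      intro m hm
      rw [Finset.mem_Icc] at hm
      exact (tsub_add_cancel_of_le (hg _ _ (by omega))).symm
    have h1 : ∑ m ∈ Finset.Icc (-((n + 1 : ℕ) : ℤ)) (n + 1 : ℕ), g m * F (x - m) =
        ∑ m ∈ Finset.Icc (-(n : ℤ)) n, (g m - b) * F (x - m) +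
          b * ∑ m ∈ Finset.Icc (-((n + 1 : ℕ) : ℤ)) (n + 1 : ℕ), F (x - m) := by
      rw [Finset.sum_subset hsub (fun m hm hm' => by rw [hvan m hm hm', zero_mul]),
        Finset.mul_sum, ← Finset.sum_add_distrib]
      refine Finset.sum_congr rfl fun m hm => ?_
      rw [← add_mul, ← hdec m hm]
    have h2 : ∑ m ∈ Finset.Icc (-((n + 1 : ℕ) : ℤ)) (n + 1 : ℕ), g m =
        ∑ m ∈ Finset.Icc (-(n : ℤ)) n, (g m - b) + b * (2 * (n + 1 : ℕ) + 1) := by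
      rw [Finset.sum_subset hsub hvan]
      have : b * (2 * ((n + 1 : ℕ) : ℝ≥0∞) + 1) =
          ∑ m ∈ Finset.Icc (-((n + 1 : ℕ) : ℤ)) (n + 1 : ℕ), b := by
        rw [Finset.sum_const, Int.card_Icc, nsmul_eq_mul, mul_comm]
        congr 1
        rw [show (((n + 1 : ℕ) : ℤ) + 1 - -((n + 1 : ℕ) : ℤ)).toNat = 2 * (n + 1) + 1 by omega]
        push_cast
        rfl
      rw [this, ← Finset.sum_add_distrib]
      exact Finset.sum_congr rfl hdec
    rw [h1, h2, add_mul, mul_assoc b]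
    gcongr
    · exact ih hg'
    · exact sum_Icc_le_hlMax F x (n + 1)

theorem SymmDecr.zconv_le_hlMax {g : ℤ → ℝ≥0∞} (hg : SymmDecr g) (F : ℤ → ℝ≥0∞) (x : ℤ) :
    _root_.zconv g F x ≤ (∑' m, g m) * hlMax F x := by
  have h : _root_.zconv g F x = ∑' m, g m * F (x - m) := by
    unfold _root_.zconv
    rw [← (Equiv.subLeft x).tsum_eq]
    simp
  rw [h, ENNReal.tsum_eq_iSup_sum' (fun n : ℕ => Finset.Icc (-(n : ℤ)) n)]
  · refine iSup_le fun n => (hg.sum_Icc_mul_le F x n).trans ?_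
    gcongr
    exact ENNReal.sum_le_tsum _
  · intro t
    refine ⟨t.sup Int.natAbs, fun m hm => ?_⟩
    have := Finset.le_sup (f := Int.natAbs) hm
    rw [Finset.mem_Icc]
    omega

/-! ### The Hardy–Littlewood maximal theorem on `ℤ` -/

theorem hlMax_le_tsum (F : ℤ → ℝ≥0∞) (x : ℤ) : hlMax F x ≤ ∑' y, F y := by
  refine iSup_le fun n => ?_
  refine (ENNReal.div_le_of_le_mul' ?_)
  calc ∑ m ∈ Finset.Icc (-(n : ℤ)) n, F (x - m) ≤ ∑' m, F (x - m) := ENNReal.sum_le_tsum _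
    _ = ∑' y, F y := (Equiv.subLeft x).tsum_eq F
    _ = 1 * ∑' y, F y := (one_mul _).symm
    _ ≤ (2 * n + 1) * ∑' y, F y := by gcongr; exact le_add_self

theorem hlMax_le_add_const {F G : ℤ → ℝ≥0∞} {b : ℝ≥0∞} (h : ∀ x, F x ≤ G x + b) (x : ℤ) :
    hlMax F x ≤ hlMax G x + b := by
  refine iSup_le fun n => ENNReal.div_le_of_le_mul' ?_
  calc ∑ m ∈ Finset.Icc (-(n : ℤ)) n, F (x - m)
      ≤ ∑ m ∈ Finset.Icc (-(n : ℤ)) n, (G (x - m) + b) := Finset.sum_le_sum fun m _ => h _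
    _ = ∑ m ∈ Finset.Icc (-(n : ℤ)) n, G (x - m) + (2 * n + 1) * b := by
        rw [Finset.sum_add_distrib, Finset.sum_const, Int.card_Icc, nsmul_eq_mul,
          show ((n : ℤ) + 1 - -(n : ℤ)).toNat = 2 * n + 1 by omega]
        push_cast
        rfl
    _ ≤ (2 * n + 1) * hlMax G x + (2 * n + 1) * b := by
        gcongr
        exact sum_Icc_le_hlMax G x n
    _ = _ := by ring

theorem Int.closedBall_natCast (x : ℤ) (n : ℕ) :
    Metric.closedBall x (n : ℝ) = Set.Icc (x - n) (x + n) := by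
  rw [Int.closedBall_eq_Icc, ← Int.cast_natCast (R := ℝ) n, ← Int.cast_sub, ← Int.cast_add,
    Int.ceil_intCast, Int.floor_intCast]

theorem sum_Icc_sub_eq_withDensity_closedBall (F : ℤ → ℝ≥0∞) (x : ℤ) (n : ℕ) :
    ∑ m ∈ Finset.Icc (-(n : ℤ)) n, F (x - m) =
      (Measure.count.withDensity F) (Metric.closedBall x (n : ℝ)) := by
  rw [Int.closedBall_natCast, withDensity_apply _ (Set.to_countable _).measurableSet,
    ← Finset.coe_Icc, ← lintegral_indicator (Set.to_countable _).measurableSet, lintegral_count,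
    tsum_eq_sum (s := Finset.Icc (x - n) (x + n))]
  · refine Finset.sum_bij' (fun m _ => x - m) (fun m _ => x - m) ?_ ?_ ?_ ?_ ?_
    · intro m hm; rw [Finset.mem_Icc] at *; omega
    · intro m hm; rw [Finset.mem_Icc] at *; omega
    · intro m _; ring
    · intro m _; ring
    · intro m hm
      rw [Set.indicator_of_mem]
      rw [Finset.coe_Icc, Set.mem_Icc]; rw [Finset.mem_Icc] at hm; omega
  · intro m hm
    rw [Set.indicator_of_notMem]
    exact_mod_cast hm

theorem mul_count_hlMax_le (F : ℤ → ℝ≥0∞) {l : ℝ≥0∞} (hl : l ≠ 0) (hl' : l ≠ ∞) :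
    l * Measure.count {x | l < hlMax F x} ≤ 5 * ∑' x, F x := by
  by_cases hF : ∑' x, F x = ∞
  · rw [hF]; simp
  set E := {x | l < hlMax F x} with hE
  set ν : Measure ℤ := Measure.count.withDensity F with hν
  have hνu : ν Set.univ = ∑' x, F x := by
    rw [hν, withDensity_apply _ MeasurableSet.univ, Measure.restrict_univ, lintegral_count]
  have hex : ∀ x : ℤ, ∃ n : ℕ, x ∈ E → l * (2 * n + 1) < ν (Metric.closedBall x (n : ℝ)) := by
    intro x
    by_cases hx : x ∈ E
    · obtain ⟨n, hn⟩ := lt_iSup_iff.1 (show l < hlMax F x from hx)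
      refine ⟨n, fun _ => ?_⟩
      rw [← sum_Icc_sub_eq_withDensity_closedBall]
      exact (ENNReal.lt_div_iff_mul_lt (by simp) (Or.inl (by finiteness))).1 hn
    · exact ⟨0, fun h => absurd h hx⟩
  choose n hn using hex
  have hR : ∀ x ∈ E, (n x : ℝ) ≤ ((∑' x, F x) / l).toReal := by
    intro x hx
    rw [← ENNReal.toReal_natCast]
    refine ENNReal.toReal_mono (ENNReal.div_ne_top hF hl) ?_
    rw [ENNReal.le_div_iff_mul_le (Or.inl hl) (Or.inl hl')]
    calc (n x : ℝ≥0∞) * l ≤ l * (2 * n x + 1) := by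
          rw [mul_comm]
          gcongr
          calc (n x : ℝ≥0∞) = 1 * n x + 0 := by simp
            _ ≤ 2 * n x + 1 := by gcongr <;> norm_num
      _ ≤ ν (Metric.closedBall x (n x : ℝ)) := (hn x hx).le
      _ ≤ ν Set.univ := measure_mono (Set.subset_univ _)
      _ = _ := hνu
  obtain ⟨u, huE, hdis, hcov⟩ :=
    Vitali.exists_disjoint_subfamily_covering_enlargement_closedBall E (fun x => x)
      (fun x => (n x : ℝ)) _ hR 5 (by norm_num)
  have hsub : E ⊆ ⋃ b ∈ u, Metric.closedBall b (5 * (n b : ℝ)) := by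
    intro x hx
    obtain ⟨b, hb, hxb⟩ := hcov x hx
    exact Set.mem_biUnion hb (hxb (Metric.mem_closedBall_self (Nat.cast_nonneg _)))
  have hcount : ∀ b : ℤ, Measure.count (Metric.closedBall b (5 * (n b : ℝ))) ≤
      5 * (2 * (n b : ℝ≥0∞) + 1) := by
    intro b
    have : (5 * (n b : ℝ)) = ((5 * n b : ℕ) : ℝ) := by push_cast; ring
    rw [this, Int.closedBall_natCast, ← Finset.coe_Icc, Measure.count_apply_finset, Int.card_Icc]
    have : (b + ((5 * n b : ℕ) : ℤ) + 1 - (b - ((5 * n b : ℕ) : ℤ))).toNat ≤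
        5 * (2 * n b + 1) := by omega
    exact_mod_cast this
  calc l * Measure.count E
      ≤ l * ∑' b : u, Measure.count (Metric.closedBall (b : ℤ) (5 * (n b : ℝ))) := by
        gcongr
        exact (measure_mono hsub).trans (measure_biUnion_le _ (Set.to_countable u) _)
    _ = ∑' b : u, l * Measure.count (Metric.closedBall (b : ℤ) (5 * (n b : ℝ))) :=
        ENNReal.tsum_mul_left.symm
    _ ≤ ∑' b : u, 5 * ν (Metric.closedBall (b : ℤ) (n b : ℝ)) := by
        refine ENNReal.tsum_le_tsum fun b => ?_
        calc l * Measure.count (Metric.closedBall (b : ℤ) (5 * (n b : ℝ)))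
            ≤ l * (5 * (2 * (n b : ℝ≥0∞) + 1)) := by gcongr; exact hcount b
          _ = 5 * (l * (2 * (n b : ℝ≥0∞) + 1)) := by ring
          _ ≤ _ := by gcongr; exact (hn b (huE b.2)).le
    _ = 5 * ν (⋃ b ∈ u, Metric.closedBall b (n b : ℝ)) := by
        rw [ENNReal.tsum_mul_left, measure_biUnion (Set.to_countable u) hdis
          fun b _ => (Set.to_countable _).measurableSet]
    _ ≤ 5 * ∑' x, F x := by
        rw [← hνu]
        gcongr
        exact Set.subset_univ _

theorem mul_count_hlMax_le_tsum_large (F : ℤ → ℝ≥0∞) {l : ℝ≥0∞} (hl : l ≠ 0) (hl' : l ≠ ∞) :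
    l * Measure.count {x | l + l < hlMax F x} ≤ 5 * ∑' x, {y | l < F y}.indicator F x := by
  refine le_trans ?_ (mul_count_hlMax_le ({y | l < F y}.indicator F) hl hl')
  refine mul_le_mul_right (measure_mono fun x (hx : l + l < hlMax F x) => ?_) l
  have h : ∀ y, F y ≤ {y | l < F y}.indicator F y + l := by
    intro y
    by_cases hy : l < F y
    · rw [Set.indicator_of_mem (by exact hy)]
      exact le_self_add
    · rw [Set.indicator_of_notMem (by exact hy), zero_add]
      exact not_lt.1 hy
  have h1 : l + l < hlMax ({y | l < F y}.indicator F) x + l :=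
    lt_of_lt_of_le hx (hlMax_le_add_const h x)
  exact lt_of_add_lt_add_right h1

theorem lintegral_Ioo_rpow {r : ℝ} (hr : -1 < r) {a : ℝ} (ha : 0 ≤ a) :
    ∫⁻ t in Set.Ioo 0 a, ENNReal.ofReal (t ^ r) = ENNReal.ofReal (a ^ (r + 1) / (r + 1)) := by
  have hint : IntegrableOn (fun t : ℝ => t ^ r) (Set.Ioo 0 a) :=
    ((intervalIntegrable_iff_integrableOn_Ioc_of_le ha).1
      (intervalIntegral.intervalIntegrable_rpow' hr)).mono_set Set.Ioo_subset_Ioc_self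
  rw [← ofReal_integral_eq_lintegral_ofReal hint]
  · congr 1
    rw [← integral_Ioc_eq_integral_Ioo, ← intervalIntegral.integral_of_le ha,
      integral_rpow (Or.inl hr), Real.zero_rpow (by linarith), sub_zero]
  · filter_upwards [ae_restrict_mem measurableSet_Ioo] with t ht
    exact Real.rpow_nonneg ht.1.le _

theorem count_hlMax_mul_rpow_le (q : ℝ) (f : ℤ → ℝ) {t : ℝ} (ht : 0 < t) :
    Measure.count {x | ENNReal.ofReal t < hlMax (fun y => ENNReal.ofReal |f y|) x} *
        ENNReal.ofReal (t ^ (q - 1)) ≤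
      ∑' y, 10 * ENNReal.ofReal |f y| *
        (Set.Ioo 0 (2 * |f y|)).indicator (fun t => ENNReal.ofReal (t ^ (q - 2))) t := by
  set F : ℤ → ℝ≥0∞ := fun y => ENNReal.ofReal |f y| with hF
  set l := ENNReal.ofReal (t / 2) with hl
  have hll : ENNReal.ofReal t = l + l := by
    rw [hl, ← ENNReal.ofReal_add (by positivity) (by positivity)]
    congr 1; ring
  have hpow : ENNReal.ofReal (t ^ (q - 1)) = l * (2 * ENNReal.ofReal (t ^ (q - 2))) := by
    rw [hl, ← ENNReal.ofReal_ofNat 2, ← ENNReal.ofReal_mul (by positivity),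
      ← ENNReal.ofReal_mul (by positivity)]
    congr 1
    rw [show q - 1 = 1 + (q - 2) by ring, Real.rpow_add ht, Real.rpow_one]
    ring
  have h := mul_count_hlMax_le_tsum_large F (l := l)
    (by rw [hl]; simpa using ht) (by rw [hl]; finiteness)
  rw [hll, hpow]
  calc Measure.count {x | l + l < hlMax F x} * (l * (2 * ENNReal.ofReal (t ^ (q - 2))))
      = l * Measure.count {x | l + l < hlMax F x} * (2 * ENNReal.ofReal (t ^ (q - 2))) := by ring
    _ ≤ 5 * (∑' x, {y | l < F y}.indicator F x) * (2 * ENNReal.ofReal (t ^ (q - 2))) := by gcongr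
    _ = ∑' x, 10 * ({y | l < F y}.indicator F x * ENNReal.ofReal (t ^ (q - 2))) := by
        rw [ENNReal.tsum_mul_left, ENNReal.tsum_mul_right]
        ring
    _ = _ := by
        refine tsum_congr fun y => ?_
        rw [mul_assoc]
        congr 1
        by_cases hy : l < F y
        · rw [Set.indicator_of_mem (by exact hy), Set.indicator_of_mem]
          have := (ENNReal.ofReal_lt_ofReal_iff_of_nonneg (by positivity)).1 hy
          exact ⟨ht, by linarith⟩
        · rw [Set.indicator_of_notMem (by exact hy), Set.indicator_of_notMem, zero_mul, mul_zero]
          rintro ⟨_, h2⟩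
          exact hy ((ENNReal.ofReal_lt_ofReal_iff_of_nonneg (by positivity)).2 (by linarith))

/-- The strong-type Hardy–Littlewood maximal inequality on `ℤ`. -/
theorem tsum_hlMax_rpow_le {q : ℝ} (hq : 1 < q) {f : ℤ → ℝ} (hf : Summable f) :
    ∑' x, hlMax (fun y => ENNReal.ofReal |f y|) x ^ q ≤
      ENNReal.ofReal (q * (10 * (2 ^ (q - 1) / (q - 1)))) *
        ∑' x, ENNReal.ofReal (|f x| ^ q) := by
  set F : ℤ → ℝ≥0∞ := fun y => ENNReal.ofReal |f y| with hF
  have hFsum : ∑' y, F y ≠ ∞ := hf.abs.tsum_ofReal_ne_top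
  have hfin : ∀ x, hlMax F x ≠ ∞ := fun x => ne_top_of_le_ne_top hFsum (hlMax_le_tsum F x)
  have hq0 : 0 < q := by linarith
  have hq1 : 0 < q - 1 := by linarith
  have h1 : ∑' x, hlMax F x ^ q =
      ∫⁻ x, ENNReal.ofReal ((hlMax F x).toReal ^ q) ∂Measure.count := by
    rw [lintegral_count]
    refine tsum_congr fun x => ?_
    rw [← ENNReal.ofReal_rpow_of_nonneg ENNReal.toReal_nonneg hq0.le, ENNReal.ofReal_toReal (hfin x)]
  rw [h1, lintegral_rpow_eq_lintegral_meas_lt_mul _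
    (Filter.Eventually.of_forall fun x => ENNReal.toReal_nonneg) (by fun_prop) hq0,
    ENNReal.ofReal_mul hq0.le, mul_assoc]
  gcongr
  calc ∫⁻ t in Set.Ioi (0 : ℝ), Measure.count {x | t < (hlMax F x).toReal} *
        ENNReal.ofReal (t ^ (q - 1))
      ≤ ∫⁻ t in Set.Ioi (0 : ℝ), ∑' y, 10 * ENNReal.ofReal |f y| *
        (Set.Ioo 0 (2 * |f y|)).indicator (fun t => ENNReal.ofReal (t ^ (q - 2))) t := by
        refine setLIntegral_mono' measurableSet_Ioi fun t ht => ?_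
        refine le_trans (le_of_eq ?_) (count_hlMax_mul_rpow_le q f ht)
        congr 2
        ext x
        exact (ENNReal.ofReal_lt_iff_lt_toReal (le_of_lt ht) (hfin x)).symm
    _ ≤ ∫⁻ t, ∑' y, 10 * ENNReal.ofReal |f y| *
        (Set.Ioo 0 (2 * |f y|)).indicator (fun t => ENNReal.ofReal (t ^ (q - 2))) t :=
        setLIntegral_le_lintegral _ _
    _ = ∑' y, 10 * ENNReal.ofReal |f y| *
          ENNReal.ofReal ((2 * |f y|) ^ (q - 1) / (q - 1)) := by
        have hm : ∀ y, Measurable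
            ((Set.Ioo 0 (2 * |f y|)).indicator fun t => ENNReal.ofReal (t ^ (q - 2))) := fun y =>
          Measurable.indicator (by fun_prop) measurableSet_Ioo
        rw [lintegral_tsum fun y => ((hm y).const_mul _).aemeasurable]
        refine tsum_congr fun y => ?_
        rw [lintegral_const_mul _ (hm y), lintegral_indicator measurableSet_Ioo,
          lintegral_Ioo_rpow (by linarith) (by positivity), show q - 2 + 1 = q - 1 by ring]
    _ = ENNReal.ofReal (10 * (2 ^ (q - 1) / (q - 1))) * ∑' x, ENNReal.ofReal (|f x| ^ q) := by
        rw [← ENNReal.tsum_mul_left]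
        refine tsum_congr fun y => ?_
        rw [← ENNReal.ofReal_ofNat 10, ← ENNReal.ofReal_mul (by positivity),
          ← ENNReal.ofReal_mul (by positivity), ← ENNReal.ofReal_mul (by positivity)]
        congr 1
        rw [Real.mul_rpow (by norm_num) (abs_nonneg _)]
        have : |f y| ^ q = |f y| * |f y| ^ (q - 1) := by
          rcases (abs_nonneg (f y)).eq_or_lt with h0 | h0
          · rw [← h0, Real.zero_rpow hq0.ne', zero_mul]
          · rw [show q = 1 + (q - 1) by ring, Real.rpow_add h0, Real.rpow_one]
            ring_nf
        rw [this]
        ring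
    _ ≤ _ := le_rfl

/-! ### The kernel of the fractional discrete Laplacian -/

section Kernel

variable {s : ℝ}

theorem Ker_neg (s : ℝ) (m : ℤ) : Ker s (-m) = Ker s m := by
  simp [Ker]

theorem Ker_sub_comm (s : ℝ) (x y : ℤ) : Ker s (x - y) = Ker s (y - x) := by
  rw [← Ker_neg, neg_sub]

theorem Gamma_ratio_nonneg (hs : s ∈ Set.Ioo (0 : ℝ) 1) {n : ℕ} (hn : 1 ≤ n) :
    0 ≤ Real.Gamma ((n : ℝ) - s) / Real.Gamma ((n : ℝ) + 1 + s) := by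
  have : (1 : ℝ) ≤ n := by exact_mod_cast hn
  have h1 : 0 < (n : ℝ) - s := by linarith [hs.2]
  have h2 : 0 < (n : ℝ) + 1 + s := by linarith [hs.1]
  exact div_nonneg (Real.Gamma_pos_of_pos h1).le (Real.Gamma_pos_of_pos h2).le

theorem Gamma_ratio_succ_le (hs : s ∈ Set.Ioo (0 : ℝ) 1) {n : ℕ} (hn : 1 ≤ n) :
    Real.Gamma (((n + 1 : ℕ) : ℝ) - s) / Real.Gamma (((n + 1 : ℕ) : ℝ) + 1 + s) ≤
      Real.Gamma ((n : ℝ) - s) / Real.Gamma ((n : ℝ) + 1 + s) := by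
  have hn' : (1 : ℝ) ≤ n := by exact_mod_cast hn
  have h1 : 0 < (n : ℝ) - s := by linarith [hs.2]
  have h2 : 0 < (n : ℝ) + 1 + s := by linarith [hs.1]
  have e1 : ((n + 1 : ℕ) : ℝ) - s = (n - s) + 1 := by push_cast; ring
  have e2 : ((n + 1 : ℕ) : ℝ) + 1 + s = (n + 1 + s) + 1 := by push_cast; ring
  rw [e1, e2, Real.Gamma_add_one h1.ne', Real.Gamma_add_one h2.ne', mul_div_mul_comm]
  refine mul_le_of_le_one_left (Gamma_ratio_nonneg hs hn) ((div_le_one h2).2 ?_)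
  linarith [hs.1]

theorem Gamma_ratio_antitone (hs : s ∈ Set.Ioo (0 : ℝ) 1) {m n : ℕ} (hm : 1 ≤ m) (hmn : m ≤ n) :
    Real.Gamma ((n : ℝ) - s) / Real.Gamma ((n : ℝ) + 1 + s) ≤
      Real.Gamma ((m : ℝ) - s) / Real.Gamma ((m : ℝ) + 1 + s) := by
  induction n, hmn using Nat.le_induction with
  | base => exact le_rfl
  | succ n hn ih => exact (Gamma_ratio_succ_le hs (hm.trans hn)).trans ih

theorem summable_Gamma_ratio (hs : s ∈ Set.Ioo (0 : ℝ) 1) :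
    Summable fun n : ℕ => Real.Gamma (((n + 1 : ℕ) : ℝ) - s) /
      Real.Gamma (((n + 1 : ℕ) : ℝ) + 1 + s) := by
  set b : ℕ → ℝ := fun n => Real.Gamma (n + 1 - s) / Real.Gamma (n + 1 + s) with hb
  have hbnn : ∀ n, 0 ≤ b n := fun n => by
    have hn : (0 : ℝ) ≤ n := n.cast_nonneg
    exact div_nonneg (Real.Gamma_pos_of_pos (by linarith [hs.2])).le
      (Real.Gamma_pos_of_pos (by linarith [hs.1])).le
  have htel : ∀ n : ℕ, Real.Gamma (((n + 1 : ℕ) : ℝ) - s) /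
      Real.Gamma (((n + 1 : ℕ) : ℝ) + 1 + s) = (b n - b (n + 1)) / (2 * s) := by
    intro n
    have hn : (0 : ℝ) ≤ n := n.cast_nonneg
    have h1 : 0 < (n : ℝ) + 1 - s := by linarith [hs.2]
    have h2 : 0 < (n : ℝ) + 1 + s := by linarith [hs.1]
    have hs0 := hs.1.ne'
    have hG := (Real.Gamma_pos_of_pos h2).ne'
    simp only [hb]
    push_cast
    rw [show (n : ℝ) + 1 + 1 - s = (n + 1 - s) + 1 by ring,
      show (n : ℝ) + 1 + 1 + s = (n + 1 + s) + 1 by ring,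
      Real.Gamma_add_one h1.ne', Real.Gamma_add_one h2.ne']
    have h2' := h2.ne'
    field_simp
    ring
  refine summable_of_sum_range_le (c := b 0 / (2 * s))
    (fun n => Gamma_ratio_nonneg hs (Nat.le_add_left 1 n)) fun n => ?_
  simp_rw [htel]
  rw [← Finset.sum_div, Finset.sum_range_sub']
  have := hs.1
  gcongr
  linarith [hbnn n]

theorem Ker_const_nonneg (hs : s ∈ Set.Ioo (0 : ℝ) 1) :
    0 ≤ (4 : ℝ) ^ s * Real.Gamma (1 / 2 + s) / (Real.sqrt Real.pi * |Real.Gamma (-s)|) := by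
  have := (Real.Gamma_pos_of_pos (show 0 < 1 / 2 + s by linarith [hs.1])).le
  positivity

theorem Ker_nonneg (hs : s ∈ Set.Ioo (0 : ℝ) 1) (m : ℤ) : 0 ≤ Ker s m := by
  unfold Ker
  split_ifs with h
  · exact le_rfl
  · exact mul_nonneg (Ker_const_nonneg hs) (Gamma_ratio_nonneg hs (by omega))

theorem Ker_le_of_natAbs_le (hs : s ∈ Set.Ioo (0 : ℝ) 1) {x y : ℤ} (hx : x ≠ 0)
    (hxy : x.natAbs ≤ y.natAbs) : Ker s y ≤ Ker s x := by
  unfold Ker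
  rw [if_neg hx, if_neg (by omega)]
  exact mul_le_mul_of_nonneg_left (Gamma_ratio_antitone hs (by omega) hxy) (Ker_const_nonneg hs)

theorem summable_Ker (hs : s ∈ Set.Ioo (0 : ℝ) 1) : Summable (Ker s) := by
  have h : Summable fun n : ℕ => Ker s n := by
    rw [← summable_nat_add_iff 1]
    refine ((summable_Gamma_ratio hs).mul_left ((4 : ℝ) ^ s * Real.Gamma (1 / 2 + s) /
      (Real.sqrt Real.pi * |Real.Gamma (-s)|))).congr fun n => ?_
    unfold Ker
    rw [if_neg (by omega), Int.natAbs_natCast]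
  refine Summable.of_nat_of_neg h ?_
  simpa only [Ker_neg] using h

/-- The kernel `Ker s`, with its value at the origin raised so as to become unimodal. -/
noncomputable def KerFill (s : ℝ) (m : ℤ) : ℝ :=
  Ker s m + if m = 0 then Ker s 1 else 0

theorem KerFill_nonneg (hs : s ∈ Set.Ioo (0 : ℝ) 1) (m : ℤ) : 0 ≤ KerFill s m := by
  unfold KerFill
  have := Ker_nonneg hs 1
  have := Ker_nonneg hs m
  positivity

theorem summable_ite_zero (c : ℝ) : Summable fun m : ℤ => if m = 0 then c else 0 :=
  (hasSum_ite_eq 0 c).summable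

theorem summable_KerFill (hs : s ∈ Set.Ioo (0 : ℝ) 1) : Summable (KerFill s) :=
  (summable_Ker hs).add (summable_ite_zero _)

theorem symmDecr_KerFill (hs : s ∈ Set.Ioo (0 : ℝ) 1) :
    SymmDecr fun m => ENNReal.ofReal (KerFill s m) := by
  intro x y hxy
  refine ENNReal.ofReal_le_ofReal ?_
  unfold KerFill
  by_cases hx : x = 0
  · subst hx
    by_cases hy : y = 0
    · rw [hy]
    · rw [if_neg hy, if_pos rfl, add_zero]
      have h1 : Ker s y ≤ Ker s 1 := Ker_le_of_natAbs_le hs one_ne_zero (by omega)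
      linarith [Ker_nonneg hs 0]
  · rw [if_neg hx, if_neg (by omega)]
    gcongr
    exact Ker_le_of_natAbs_le hs hx hxy

end Kernel

/-! ### The semigroup on bounded functions -/

open scoped BoundedContinuousFunction

section ExpOperator

variable {E : Type*} [NormedAddCommGroup E] [NormedSpace ℝ E]

/-- The exponential of a bounded operator on a real normed space. -/
noncomputable def expCLM (A : E →L[ℝ] E) : E →L[ℝ] E := NormedSpace.exp A

theorem expCLM_zero : expCLM (0 : E →L[ℝ] E) = 1 := NormedSpace.exp_zero

theorem expCLM_neg_smul (A : E →L[ℝ] E) (t : ℝ) : expCLM ((-t) • A) = expCLM (t • (-A)) := by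
  rw [neg_smul, smul_neg]

variable [CompleteSpace E]

theorem hasSum_expCLM_smul (A : E →L[ℝ] E) (t : ℝ) (f : E) (φ : E →L[ℝ] ℝ) :
    HasSum (fun n : ℕ => t ^ n / (n.factorial : ℝ) * φ ((A ^ n) f)) (φ (expCLM (t • A) f)) := by
  have h := (φ.comp (ContinuousLinearMap.apply ℝ E f)).hasSum
    (NormedSpace.exp_series_hasSum_exp' (𝕂 := ℝ) (t • A))
  convert h using 2 with n
  · rw [smul_pow, smul_smul]
    simp only [ContinuousLinearMap.comp_apply, map_smul, ContinuousLinearMap.apply_apply,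
      smul_eq_mul]
    ring
  · rfl

theorem hasDerivAt_expCLM_smul (A : E →L[ℝ] E) (t : ℝ) (f : E) (φ : E →L[ℝ] ℝ) :
    HasDerivAt (fun t : ℝ => φ (expCLM (t • A) f)) (φ (A (expCLM (t • A) f))) t :=
  (φ.comp (ContinuousLinearMap.apply ℝ E f)).hasFDerivAt.comp_hasDerivAt t
    (hasDerivAt_exp_smul_const' (𝕂 := ℝ) A t)

theorem continuous_expCLM_smul (A : E →L[ℝ] E) (f : E) (φ : E →L[ℝ] ℝ) :
    Continuous fun t : ℝ => φ (expCLM (t • A) f) :=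
  continuous_iff_continuousAt.2 fun t => (hasDerivAt_expCLM_smul A t f φ).continuousAt

theorem expCLM_neg_smul_smul_one_sub (c t : ℝ) (A : E →L[ℝ] E) :
    expCLM ((-t) • (c • (1 : E →L[ℝ] E) - A)) = Real.exp (-(t * c)) • expCLM (t • A) := by
  let _ : NormedAlgebra ℚ (E →L[ℝ] E) := NormedAlgebra.restrictScalars ℚ ℝ _
  have h0 : (-t) • (c • (1 : E →L[ℝ] E) - A) = (-(t * c)) • (1 : E →L[ℝ] E) + t • A := by
    rw [smul_sub, smul_smul, neg_smul t A, sub_neg_eq_add, neg_mul]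
  have h1 : NormedSpace.exp ((-(t * c)) • (1 : E →L[ℝ] E)) =
      Real.exp (-(t * c)) • (1 : E →L[ℝ] E) := by
    rw [← Algebra.algebraMap_eq_smul_one, ← Algebra.algebraMap_eq_smul_one, Real.exp_eq_exp_ℝ]
    exact (NormedSpace.algebraMap_exp_comm _).symm
  rw [h0]
  unfold expCLM
  rw [NormedSpace.exp_add_of_commute ((Commute.one_left _).smul_left _), h1, smul_one_mul]

end ExpOperator

section Semigroup

theorem Summable.comp_sub_left {k : ℤ → ℝ} (hk : Summable k) (x : ℤ) :
    Summable fun y => k (x - y) :=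
  (Equiv.subLeft x).summable_iff.2 hk

theorem Summable.comp_sub_left_mul_bounded {k : ℤ → ℝ} (hk : Summable k) (x : ℤ) {h : ℤ → ℝ}
    {C : ℝ} (hC : ∀ y, |h y| ≤ C) : Summable fun y => k (x - y) * h y := by
  refine Summable.of_norm_bounded ((hk.comp_sub_left x).abs.mul_right C) fun y => ?_
  rw [norm_mul, Real.norm_eq_abs, Real.norm_eq_abs]
  gcongr
  exact hC y

theorem tsum_comp_sub_left (k : ℤ → ℝ) (x : ℤ) : ∑' y, k (x - y) = ∑' m, k m :=
  (Equiv.subLeft x).tsum_eq k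

theorem abs_tsum_comp_sub_left_mul_le {k : ℤ → ℝ} (hk : Summable k) (x : ℤ) (h : ℤ →ᵇ ℝ) :
    ‖∑' y, k (x - y) * h y‖ ≤ (∑' m, |k m|) * ‖h‖ := by
  refine tsum_of_norm_bounded (g := fun y => |k (x - y)| * ‖h‖) ?_ fun y => ?_
  · have := ((hk.comp_sub_left x).abs.mul_right ‖h‖).hasSum
    rwa [tsum_mul_right, tsum_comp_sub_left (fun m => |k m|)] at this
  · rw [norm_mul, Real.norm_eq_abs]
    gcongr
    exact h.norm_coe_le_norm y

/-- Convolution with a summable kernel, as a bounded operator on bounded functions on `ℤ`. -/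
noncomputable def convCLM (k : ℤ → ℝ) (hk : Summable k) : (ℤ →ᵇ ℝ) →L[ℝ] (ℤ →ᵇ ℝ) :=
  LinearMap.mkContinuous
    { toFun := fun h => BoundedContinuousFunction.ofNormedAddCommGroupDiscrete
        (fun x => ∑' y, k (x - y) * h y) ((∑' m, |k m|) * ‖h‖)
        fun x => abs_tsum_comp_sub_left_mul_le hk x h
      map_add' := fun g h => by
        ext x
        simp only [BoundedContinuousFunction.coe_ofNormedAddCommGroupDiscrete,
          BoundedContinuousFunction.coe_add, Pi.add_apply, mul_add]
        exact (hk.comp_sub_left_mul_bounded x g.norm_coe_le_norm).tsum_add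
          (hk.comp_sub_left_mul_bounded x h.norm_coe_le_norm)
      map_smul' := fun c h => by
        ext x
        simp only [BoundedContinuousFunction.coe_ofNormedAddCommGroupDiscrete,
          BoundedContinuousFunction.coe_smul, smul_eq_mul, RingHom.id_apply]
        rw [← tsum_mul_left]
        exact tsum_congr fun y => by ring }
    (∑' m, |k m|) fun h => by
      refine (BoundedContinuousFunction.norm_le (by positivity)).2 fun x => ?_
      exact abs_tsum_comp_sub_left_mul_le hk x h

theorem convCLM_apply (k : ℤ → ℝ) (hk : Summable k) (h : ℤ →ᵇ ℝ) (x : ℤ) :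
    convCLM k hk h x = ∑' y, k (x - y) * h y := rfl

theorem enorm_convCLM_pow_le {k : ℤ → ℝ} (hk : Summable k) (hk0 : ∀ m, 0 ≤ k m)
    (hkd : SymmDecr fun m => ENNReal.ofReal (k m)) (f : ℤ →ᵇ ℝ) (n : ℕ) (x : ℤ) :
    ‖(convCLM k hk ^ n) f x‖ₑ ≤ ENNReal.ofReal ((∑' m, k m) ^ n) * hlMax (fun y => ‖f y‖ₑ) x := by
  have key : ∃ g : ℤ → ℝ≥0∞, SymmDecr g ∧ ∑' m, g m = ENNReal.ofReal ((∑' m, k m) ^ n) ∧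
      ∀ x, ‖(convCLM k hk ^ n) f x‖ₑ ≤ zconv g (fun y => ‖f y‖ₑ) x := by
    induction n with
    | zero =>
      refine ⟨fun m => if m = 0 then 1 else 0, ?_, ?_, ?_⟩
      · intro x y hxy
        by_cases hx : x = 0
        · simp only [hx, if_true]
          split_ifs <;> simp
        · have hy : y ≠ 0 := by omega
          simp only [hx, hy, if_false, le_refl]
      · rw [tsum_ite_eq]; simp
      · intro x
        unfold zconv
        rw [tsum_eq_single x]
        · simp
        · intro y hy
          have : x - y ≠ 0 := by omega
          simp only [this, if_false, zero_mul]
    | succ n ih =>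
      obtain ⟨g, hg, hgs, hgb⟩ := ih
      refine ⟨zconv (fun m => ENNReal.ofReal (k m)) g, hkd.zconv hg, ?_, fun x => ?_⟩
      · rw [tsum_zconv, hgs, ← ENNReal.ofReal_tsum_of_nonneg hk0 hk,
          ← ENNReal.ofReal_mul (tsum_nonneg hk0), pow_succ']
      · rw [← zconv_assoc, pow_succ', mul_apply_eq_comp, convCLM_apply]
        refine enorm_tsum_le_tsum_enorm.trans (ENNReal.tsum_le_tsum fun y => ?_)
        rw [enorm_mul, Real.enorm_eq_ofReal (hk0 _)]
        gcongr
        exact hgb y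
  obtain ⟨g, hg, hgs, hgb⟩ := key
  rw [← hgs]
  exact (hgb x).trans (hg.zconv_le_hlMax _ x)

variable {s : ℝ}

/-- The fractional discrete Laplacian as a bounded operator on bounded functions. -/
noncomputable def LopCLM (hs : s ∈ Set.Ioo (0 : ℝ) 1) : (ℤ →ᵇ ℝ) →L[ℝ] (ℤ →ᵇ ℝ) :=
  (∑' m, KerFill s m) • 1 - convCLM (KerFill s) (summable_KerFill hs)

theorem LopCLM_apply (hs : s ∈ Set.Ioo (0 : ℝ) 1) (f : ℤ →ᵇ ℝ) (x : ℤ) :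
    LopCLM hs f x = Lop s f x := by
  have h1 : Summable fun y => KerFill s (x - y) * f y :=
    (summable_KerFill hs).comp_sub_left_mul_bounded x f.norm_coe_le_norm
  have h2 : Summable fun y => KerFill s (x - y) * f x :=
    ((summable_KerFill hs).comp_sub_left x).mul_right _
  change (∑' m, KerFill s m) * f x - ∑' y, KerFill s (x - y) * f y = _
  rw [← tsum_comp_sub_left (KerFill s) x, ← tsum_mul_right, ← h2.tsum_sub h1]
  refine tsum_congr fun y => ?_
  unfold KerFill
  by_cases hy : x - y = 0
  · have : x = y := by omega
    subst this
    ring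
  · rw [if_neg hy]
    ring

theorem LopCLM_pow_apply (hs : s ∈ Set.Ioo (0 : ℝ) 1) (f : ℤ →ᵇ ℝ) (n : ℕ) :
    ⇑((LopCLM hs ^ n) f) = (Lop s)^[n] f := by
  induction n with
  | zero => rfl
  | succ n ih =>
    rw [Function.iterate_succ_apply', ← ih, pow_succ']
    ext x
    exact LopCLM_apply hs _ x

theorem heat_eq_expCLM (hs : s ∈ Set.Ioo (0 : ℝ) 1) (t : ℝ) (f : ℤ →ᵇ ℝ) :
    heat s t f = expCLM ((-t) • LopCLM hs) f := by
  ext x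
  have h := hasSum_expCLM_smul (LopCLM hs) (-t) f (BoundedContinuousFunction.evalCLM ℝ x)
  simp only [BoundedContinuousFunction.evalCLM_apply] at h
  rw [← h.tsum_eq]
  simp only [heat, LopCLM_pow_apply]

theorem heat_zero (hs : s ∈ Set.Ioo (0 : ℝ) 1) (f : ℤ →ᵇ ℝ) : heat s 0 f = f := by
  rw [heat_eq_expCLM hs, neg_zero, zero_smul, expCLM_zero]
  rfl

theorem hasDerivAt_heat (hs : s ∈ Set.Ioo (0 : ℝ) 1) (f : ℤ →ᵇ ℝ) (t : ℝ) (x : ℤ) :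
    HasDerivAt (fun t => heat s t f x) (-Lop s (heat s t f) x) t := by
  simp only [heat_eq_expCLM hs]
  rw [← LopCLM_apply hs]
  have h := hasDerivAt_expCLM_smul (-LopCLM hs) t f (BoundedContinuousFunction.evalCLM ℝ x)
  simp only [expCLM_neg_smul]
  exact h

theorem continuous_Lop_heat (hs : s ∈ Set.Ioo (0 : ℝ) 1) (f : ℤ →ᵇ ℝ) (x : ℤ) :
    Continuous fun t => Lop s (heat s t f) x := by
  simp only [heat_eq_expCLM hs]
  simp only [← LopCLM_apply hs]
  have h := continuous_expCLM_smul (-LopCLM hs) f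
    ((BoundedContinuousFunction.evalCLM ℝ x).comp (LopCLM hs))
  simp only [expCLM_neg_smul]
  exact h

/-- The heat semigroup is dominated by the Hardy–Littlewood maximal function. -/
theorem enorm_heat_le_hlMax (hs : s ∈ Set.Ioo (0 : ℝ) 1) (f : ℤ →ᵇ ℝ) {t : ℝ} (ht : 0 ≤ t)
    (x : ℤ) : ‖heat s t f x‖ₑ ≤ hlMax (fun y => ‖f y‖ₑ) x := by
  set T := convCLM (KerFill s) (summable_KerFill hs) with hT
  set a := ∑' m, KerFill s m with ha
  have ha0 : 0 ≤ a := tsum_nonneg (KerFill_nonneg hs)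
  have hexp : expCLM ((-t) • LopCLM hs) = Real.exp (-(t * a)) • expCLM (t • T) :=
    expCLM_neg_smul_smul_one_sub a t T
  have h1 : ‖expCLM (t • T) f x‖ₑ ≤
      ENNReal.ofReal (Real.exp (t * a)) * hlMax (fun y => ‖f y‖ₑ) x := by
    have hsum := hasSum_expCLM_smul T t f (BoundedContinuousFunction.evalCLM ℝ x)
    simp only [BoundedContinuousFunction.evalCLM_apply] at hsum
    rw [← hsum.tsum_eq]
    have hterm : ∀ n : ℕ, ‖t ^ n / (n.factorial : ℝ) * (T ^ n) f x‖ₑ ≤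
        ENNReal.ofReal ((t * a) ^ n / n.factorial) * hlMax (fun y => ‖f y‖ₑ) x := by
      intro n
      rw [enorm_mul, Real.enorm_eq_ofReal (by positivity)]
      calc _ ≤ ENNReal.ofReal (t ^ n / (n.factorial : ℝ)) *
            (ENNReal.ofReal (a ^ n) * hlMax (fun y => ‖f y‖ₑ) x) := by
              gcongr
              exact enorm_convCLM_pow_le _ (KerFill_nonneg hs) (symmDecr_KerFill hs) f n x
        _ = _ := by
          rw [← mul_assoc, ← ENNReal.ofReal_mul (by positivity), mul_pow]
          congr 2
          ring
    refine enorm_tsum_le_tsum_enorm.trans ((ENNReal.tsum_le_tsum hterm).trans (le_of_eq ?_))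
    rw [ENNReal.tsum_mul_right, ← ENNReal.ofReal_tsum_of_nonneg (fun n => by positivity)
      (Real.summable_pow_div_factorial _), Real.exp_eq_exp_ℝ, NormedSpace.exp_eq_tsum_div]
  rw [heat_eq_expCLM hs, hexp]
  change ‖Real.exp (-(t * a)) * expCLM (t • T) f x‖ₑ ≤ _
  rw [enorm_mul, Real.enorm_eq_ofReal (Real.exp_pos _).le]
  calc _ ≤ ENNReal.ofReal (Real.exp (-(t * a))) *
        (ENNReal.ofReal (Real.exp (t * a)) * hlMax (fun y => ‖f y‖ₑ) x) := by gcongr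
    _ = hlMax (fun y => ‖f y‖ₑ) x := by
      rw [← mul_assoc, ← ENNReal.ofReal_mul (Real.exp_pos _).le, ← Real.exp_add]
      simp

end Semigroup

/-! ### The pseudo-gradient -/

/-- The Bregman divergence of `z ↦ |z| ^ q`: the error of its first-order expansion at `a`. -/
noncomputable def rpowBregman (q a b : ℝ) : ℝ :=
  |b| ^ q - |a| ^ q - q * |a| ^ (q - 2) * a * (b - a)

theorem rpow_taylor_Icc {q r : ℝ} (hq : q ∈ Set.Ioc (1 : ℝ) 2) (h0 : 0 ≤ r) (h1 : r ≤ 1) :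
    q * (q - 1) / 2 * (r - 1) ^ 2 ≤ r ^ q - 1 - q * (r - 1) := by
  obtain ⟨hq1, hq2⟩ := hq
  set h : ℝ → ℝ := fun r => r ^ q - 1 - q * (r - 1) - q * (q - 1) / 2 * (r - 1) ^ 2 with hh
  have hd : ∀ x, HasDerivAt h (q * x ^ (q - 1) - q - q * (q - 1) * (x - 1)) x := by
    intro x
    have e1 := Real.hasDerivAt_rpow_const (x := x) (p := q) (Or.inr hq1.le)
    have e2 := (hasDerivAt_id x).sub_const (1 : ℝ)
    have := ((e1.sub_const 1).sub (e2.const_mul q)).sub ((e2.pow 2).const_mul (q * (q - 1) / 2))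
    refine this.congr_deriv ?_
    simp
    ring
  have hanti : AntitoneOn h (Set.Icc 0 1) := by
    refine antitoneOn_of_deriv_nonpos (convex_Icc 0 1)
      (fun x _ => (hd x).continuousAt.continuousWithinAt)
      (fun x _ => (hd x).differentiableAt.differentiableWithinAt) fun x hx => ?_
    rw [interior_Icc] at hx
    rw [(hd x).deriv]
    have hb := rpow_one_add_le_one_add_mul_self (s := x - 1) (p := q - 1)
      (by linarith [hx.1]) (by linarith) (by linarith)
    rw [add_sub_cancel] at hb
    nlinarith
  have := hanti ⟨h0, h1⟩ ⟨zero_le_one, le_rfl⟩ h1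
  simp only [hh, Real.one_rpow] at this
  linarith

theorem abs_rpow_taylor {q r : ℝ} (hq : q ∈ Set.Ioc (1 : ℝ) 2) (hr : |r| ≤ 1) :
    q * (q - 1) / 2 * (r - 1) ^ 2 ≤ |r| ^ q - 1 - q * (r - 1) := by
  rcases le_total 0 r with h0 | h0
  · rw [abs_of_nonneg h0] at hr ⊢
    exact rpow_taylor_Icc hq h0 hr
  · obtain ⟨hq1, hq2⟩ := hq
    have hp : |r| ^ (2 : ℝ) ≤ |r| ^ q :=
      Real.rpow_le_rpow_of_exponent_ge' (abs_nonneg r) hr (by linarith) hq2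
    rw [Real.rpow_two, sq_abs] at hp
    nlinarith [mul_nonneg (mul_nonneg (by linarith : 0 ≤ q) (by linarith : 0 ≤ 2 - q))
      (neg_nonneg.2 h0), mul_nonneg (by linarith : 0 ≤ q - 1) (by linarith : 0 ≤ 2 - q),
      mul_nonneg (mul_nonneg (by linarith : 0 ≤ q + 1) (by linarith : 0 ≤ 2 - q)) (sq_nonneg r)]

theorem one_add_mul_le_abs_rpow {q : ℝ} (hq : 1 ≤ q) (r : ℝ) : 0 ≤ |r| ^ q - 1 - q * (r - 1) := by
  rcases le_total 0 r with h0 | h0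
  · have := one_add_mul_self_le_rpow_one_add (s := r - 1) (by linarith) hq
    rw [add_sub_cancel] at this
    rw [abs_of_nonneg h0]
    linarith
  · have := Real.rpow_nonneg (abs_nonneg r) q
    nlinarith

theorem rpowBregman_eq {q a : ℝ} (ha : a ≠ 0) (b : ℝ) :
    rpowBregman q a b = |a| ^ q * (|b / a| ^ q - 1 - q * (b / a - 1)) := by
  have ha' : 0 < |a| := abs_pos.2 ha
  have h1 : |b| ^ q = |a| ^ q * |b / a| ^ q := by
    rw [← Real.mul_rpow (abs_nonneg _) (abs_nonneg _), ← abs_mul, mul_div_cancel₀ _ ha]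
  have h2 : |a| ^ q = |a| ^ (q - 2) * a ^ 2 := by
    rw [← sq_abs, ← Real.rpow_two, ← Real.rpow_add ha', sub_add_cancel]
  have h3 : q * |a| ^ (q - 2) * a * (b - a) = |a| ^ q * (q * (b / a - 1)) := by
    rw [h2]
    field_simp
  unfold rpowBregman
  rw [h1, h3]
  ring

theorem rpowBregman_nonneg {q : ℝ} (hq : 1 < q) (a b : ℝ) : 0 ≤ rpowBregman q a b := by
  rcases eq_or_ne a 0 with rfl | ha
  · unfold rpowBregman
    rw [abs_zero, Real.zero_rpow (by linarith)]
    have := Real.rpow_nonneg (abs_nonneg b) q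
    linarith
  · rw [rpowBregman_eq ha]
    exact mul_nonneg (Real.rpow_nonneg (abs_nonneg _) _) (one_add_mul_le_abs_rpow hq.le _)

theorem sq_le_rpow_mul_rpowBregman {q a b : ℝ} (hq : q ∈ Set.Ioc (1 : ℝ) 2) (hab : |b| < |a|) :
    q * (q - 1) / 2 * (a - b) ^ 2 ≤ |a| ^ (2 - q) * rpowBregman q a b := by
  have ha' : 0 < |a| := (abs_nonneg b).trans_lt hab
  have ha : a ≠ 0 := abs_pos.1 ha'
  have h := abs_rpow_taylor hq (r := b / a) (by rw [abs_div]; exact (div_le_one ha').2 hab.le)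
  rw [rpowBregman_eq ha, ← mul_assoc, ← Real.rpow_add ha', sub_add_cancel, Real.rpow_two, sq_abs]
  calc q * (q - 1) / 2 * (a - b) ^ 2 = a ^ 2 * (q * (q - 1) / 2 * (b / a - 1) ^ 2) := by
        field_simp
        ring
    _ ≤ _ := by gcongr

section PseudoGradient

variable {s q : ℝ}

/-- The pseudo-gradient `Γ_q(u) = q |u|^{q-2} u Lu - L|u|^q`. -/
noncomputable def pseudoGrad (s q : ℝ) (u : ℤ → ℝ) (x : ℤ) : ℝ :=
  ∑' y, Ker s (x - y) * rpowBregman q (u x) (u y)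

variable {u : ℤ → ℝ} {C : ℝ}

theorem hasSum_pseudoGrad (hs : s ∈ Set.Ioo (0 : ℝ) 1) (hq : 0 ≤ q) (hC : ∀ y, |u y| ≤ C) (x : ℤ) :
    HasSum (fun y => Ker s (x - y) * rpowBregman q (u x) (u y))
      (∑' y, Ker s (x - y) * |u y| ^ q - (∑' m, Ker s m) * |u x| ^ q +
        q * |u x| ^ (q - 2) * u x * Lop s u x) := by
  have hK := (summable_Ker hs).comp_sub_left x
  have h1 : Summable fun y => Ker s (x - y) * |u y| ^ q :=
    (summable_Ker hs).comp_sub_left_mul_bounded x (C := C ^ q) fun y => by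
      rw [abs_of_nonneg (Real.rpow_nonneg (abs_nonneg _) _)]
      exact Real.rpow_le_rpow (abs_nonneg _) (hC y) hq
  have h2 : Summable fun y => (u x - u y) * Ker s (x - y) := by
    refine ((hK.mul_right (u x)).sub
      ((summable_Ker hs).comp_sub_left_mul_bounded x hC)).congr fun y => ?_
    ring
  have h3 := hK.hasSum.mul_right (|u x| ^ q)
  rw [tsum_comp_sub_left] at h3
  have h := (h1.hasSum.sub h3).add (h2.hasSum.mul_left (q * |u x| ^ (q - 2) * u x))
  have e : (fun y => Ker s (x - y) * rpowBregman q (u x) (u y)) = fun y =>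
      Ker s (x - y) * |u y| ^ q - Ker s (x - y) * |u x| ^ q +
        q * |u x| ^ (q - 2) * u x * ((u x - u y) * Ker s (x - y)) := by
    ext y
    unfold rpowBregman
    ring
  rw [e]
  exact h

theorem pseudoGrad_nonneg (hs : s ∈ Set.Ioo (0 : ℝ) 1) (hq : 1 < q) (u : ℤ → ℝ) (x : ℤ) :
    0 ≤ pseudoGrad s q u x :=
  tsum_nonneg fun _ => mul_nonneg (Ker_nonneg hs _) (rpowBregman_nonneg hq _ _)

theorem mgradSq_le_pseudoGrad (hs : s ∈ Set.Ioo (0 : ℝ) 1) (hq : q ∈ Set.Ioc (1 : ℝ) 2)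
    (hC : ∀ y, |u y| ≤ C) (x : ℤ) :
    q * (q - 1) / 2 * mgradSq s u x ≤ |u x| ^ (2 - q) * pseudoGrad s q u x := by
  have hsum := (hasSum_pseudoGrad hs (by linarith [hq.1]) hC x).summable
  have hsum' := (hsum.mul_left (|u x| ^ (2 - q))).subtype {y | |u y| < |u x|}
  have hnn : ∀ y, 0 ≤ |u x| ^ (2 - q) * (Ker s (x - y) * rpowBregman q (u x) (u y)) := fun y =>
    mul_nonneg (Real.rpow_nonneg (abs_nonneg _) _)
      (mul_nonneg (Ker_nonneg hs _) (rpowBregman_nonneg hq.1 _ _))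
  have hc : 0 ≤ q * (q - 1) / 2 := by nlinarith [hq.1]
  have hle : ∀ y : {y : ℤ // |u y| < |u x|},
      q * (q - 1) / 2 * (Ker s ((y : ℤ) - x) * (u x - u y) ^ 2) ≤
        |u x| ^ (2 - q) * (Ker s (x - y) * rpowBregman q (u x) (u y)) := by
    rintro ⟨y, hy⟩
    have := mul_le_mul_of_nonneg_left (sq_le_rpow_mul_rpowBregman hq hy) (Ker_nonneg hs (x - y))
    rw [Ker_sub_comm s y x]
    linarith
  unfold mgradSq pseudoGrad
  rw [← tsum_mul_left, ← tsum_mul_left]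
  have hsl : Summable fun y : {y : ℤ // |u y| < |u x|} =>
      q * (q - 1) / 2 * (Ker s ((y : ℤ) - x) * (u x - u y) ^ 2) :=
    Summable.of_nonneg_of_le
      (fun y => mul_nonneg hc (mul_nonneg (Ker_nonneg hs _) (sq_nonneg _))) hle hsum'
  refine (hsl.tsum_le_tsum hle hsum').trans ?_
  exact Summable.tsum_subtype_le _ {y | |u y| < |u x|} hnn (hsum.mul_left _)

end PseudoGradient

/-! ### The energy estimate along the heat flow -/

section Energy

variable {s q : ℝ} {f : ℤ →ᵇ ℝ} {C : ℝ}

theorem continuous_heat (hs : s ∈ Set.Ioo (0 : ℝ) 1) (f : ℤ →ᵇ ℝ) (x : ℤ) :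
    Continuous fun t => heat s t f x :=
  continuous_iff_continuousAt.2 fun t => (hasDerivAt_heat hs f t x).continuousAt

theorem continuous_abs_heat_rpow (hs : s ∈ Set.Ioo (0 : ℝ) 1) (hq : 0 ≤ q) (f : ℤ →ᵇ ℝ) (x : ℤ) :
    Continuous fun t => |heat s t f x| ^ q :=
  (continuous_heat hs f x).abs.rpow_const fun _ => Or.inr hq

theorem continuous_abs_rpow_sub_two_mul (hq : 1 < q) :
    Continuous fun z : ℝ => q * |z| ^ (q - 2) * z := by
  have h := (contDiff_norm_rpow (E := ℝ) hq).continuous_deriv le_rfl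
  convert h using 1
  ext z
  exact (hasDerivAt_abs_rpow z hq).deriv.symm

theorem continuousOn_tsum_Ker_mul_heat (hs : s ∈ Set.Ioo (0 : ℝ) 1) (hq : 0 ≤ q)
    (hC : ∀ t, 0 ≤ t → ∀ y, |heat s t f y| ≤ C) (x : ℤ) :
    ContinuousOn (fun t => ∑' y, Ker s (x - y) * |heat s t f y| ^ q) (Set.Ici 0) := by
  refine continuousOn_tsum (u := fun y => Ker s (x - y) * C ^ q)
    (fun y => (continuous_const.mul (continuous_abs_heat_rpow hs hq f y)).continuousOn)
    (((summable_Ker hs).comp_sub_left x).mul_right _) fun y t ht => ?_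
  rw [norm_mul, Real.norm_of_nonneg (Ker_nonneg hs _),
    Real.norm_of_nonneg (Real.rpow_nonneg (abs_nonneg _) _)]
  exact mul_le_mul_of_nonneg_left (Real.rpow_le_rpow (abs_nonneg _) (hC t ht y) hq)
    (Ker_nonneg hs _)

theorem continuousOn_pseudoGrad_heat (hs : s ∈ Set.Ioo (0 : ℝ) 1) (hq : 1 < q)
    (hC : ∀ t, 0 ≤ t → ∀ y, |heat s t f y| ≤ C) (x : ℤ) :
    ContinuousOn (fun t => pseudoGrad s q (heat s t f) x) (Set.Ici 0) := by
  have h0 : 0 ≤ q := by linarith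
  refine (((continuousOn_tsum_Ker_mul_heat hs h0 hC x).sub
    ((continuous_const (y := ∑' m, Ker s m)).mul
      (continuous_abs_heat_rpow hs h0 f x)).continuousOn).add
    (((continuous_abs_rpow_sub_two_mul hq).comp (continuous_heat hs f x)).mul
      (continuous_Lop_heat hs f x)).continuousOn).congr fun t ht => ?_
  exact (hasSum_pseudoGrad hs h0 (hC t ht) x).tsum_eq

theorem hasDerivAt_abs_heat_rpow (hs : s ∈ Set.Ioo (0 : ℝ) 1) (hq : 1 < q)
    (hC : ∀ t, 0 ≤ t → ∀ y, |heat s t f y| ≤ C) (x : ℤ) {t : ℝ} (ht : 0 ≤ t) :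
    HasDerivAt (fun t => |heat s t f x| ^ q)
      (∑' y, Ker s (x - y) * |heat s t f y| ^ q - (∑' m, Ker s m) * |heat s t f x| ^ q -
        pseudoGrad s q (heat s t f) x) t := by
  have h := (hasDerivAt_abs_rpow (heat s t f x) hq).comp t (hasDerivAt_heat hs f t x)
  refine h.congr_deriv ?_
  unfold pseudoGrad
  rw [(hasSum_pseudoGrad hs (by linarith) (hC t ht) x).tsum_eq]
  ring

theorem ofReal_intervalIntegral {g : ℝ → ℝ} {N : ℝ} (hN : 0 ≤ N)
    (hg : ContinuousOn g (Set.Ici 0)) (h0 : ∀ t, 0 ≤ t → 0 ≤ g t) :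
    ENNReal.ofReal (∫ t in (0 : ℝ)..N, g t) = ∫⁻ t in Set.Ioc 0 N, ENNReal.ofReal (g t) := by
  rw [intervalIntegral.integral_of_le hN]
  refine ofReal_integral_eq_lintegral_ofReal ?_ ?_
  · exact ((hg.mono Set.Icc_subset_Ici_self).integrableOn_Icc).mono_set Set.Ioc_subset_Icc_self
  · exact (ae_restrict_iff' measurableSet_Ioc).2 (Filter.Eventually.of_forall fun t ht => h0 t ht.1.le)

theorem lintegral_pseudoGrad_add_le (hs : s ∈ Set.Ioo (0 : ℝ) 1) (hq : 1 < q)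
    (hC : ∀ t, 0 ≤ t → ∀ y, |heat s t f y| ≤ C) (x : ℤ) {N : ℝ} (hN : 0 ≤ N) :
    (∫⁻ t in Set.Ioc 0 N, ENNReal.ofReal (pseudoGrad s q (heat s t f) x)) +
        ENNReal.ofReal (∑' m, Ker s m) *
          (∫⁻ t in Set.Ioc 0 N, ENNReal.ofReal (|heat s t f x| ^ q)) ≤
      ENNReal.ofReal (|f x| ^ q) + ∑' y, ENNReal.ofReal (Ker s (x - y)) *
          ∫⁻ t in Set.Ioc 0 N, ENNReal.ofReal (|heat s t f y| ^ q) := by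
  have h0 : 0 ≤ q := by linarith
  have hκ : 0 ≤ ∑' m, Ker s m := tsum_nonneg (Ker_nonneg hs)
  have cS := continuousOn_tsum_Ker_mul_heat hs h0 hC x
  have cG := continuousOn_pseudoGrad_heat hs hq hC x
  have cV := (continuous_abs_heat_rpow hs h0 f x).continuousOn (s := Set.Ici 0)
  have nV : ∀ y t, 0 ≤ |heat s t f y| ^ q := fun y t => Real.rpow_nonneg (abs_nonneg _) _
  have nK : ∀ y t, 0 ≤ Ker s (x - y) * |heat s t f y| ^ q := fun y t =>
    mul_nonneg (Ker_nonneg hs _) (nV y t)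
  have hsub : Set.uIcc 0 N ⊆ Set.Ici 0 := by
    rw [Set.uIcc_of_le hN]; exact Set.Icc_subset_Ici_self
  have iS := (cS.mono hsub).intervalIntegrable (μ := volume)
  have iG := (cG.mono hsub).intervalIntegrable (μ := volume)
  have iV := (cV.mono hsub).intervalIntegrable (μ := volume) |>.const_mul (∑' m, Ker s m)
  have hftc := intervalIntegral.integral_eq_sub_of_hasDerivAt
    (fun t ht => hasDerivAt_abs_heat_rpow hs hq hC x (hsub ht)) ((iS.sub iV).sub iG)
  rw [intervalIntegral.integral_sub (iS.sub iV) iG, intervalIntegral.integral_sub iS iV,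
    intervalIntegral.integral_const_mul, heat_zero hs] at hftc
  have hS : ENNReal.ofReal (∫ t in (0 : ℝ)..N, ∑' y, Ker s (x - y) * |heat s t f y| ^ q) =
      ∑' y, ENNReal.ofReal (Ker s (x - y)) *
          ∫⁻ t in Set.Ioc 0 N, ENNReal.ofReal (|heat s t f y| ^ q) := by
    rw [ofReal_intervalIntegral hN cS fun t _ => tsum_nonneg fun y => nK y t]
    have hm : ∀ y, Measurable fun t => ENNReal.ofReal (|heat s t f y| ^ q) := fun y =>
      (continuous_abs_heat_rpow hs h0 f y).measurable.ennreal_ofReal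
    calc _ = ∫⁻ t in Set.Ioc 0 N, ∑' y, ENNReal.ofReal (Ker s (x - y)) *
          ENNReal.ofReal (|heat s t f y| ^ q) := by
          refine setLIntegral_congr_fun measurableSet_Ioc fun t ht => ?_
          have hsum : Summable fun y => Ker s (x - y) * |heat s t f y| ^ q :=
            (summable_Ker hs).comp_sub_left_mul_bounded x (C := C ^ q) fun y => by
              rw [abs_of_nonneg (nV y t)]
              exact Real.rpow_le_rpow (abs_nonneg _) (hC t ht.1.le y) h0
          simp only [← ENNReal.ofReal_mul (Ker_nonneg hs _)]
          exact ENNReal.ofReal_tsum_of_nonneg (fun y => nK y t) hsum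
      _ = _ := by
          rw [lintegral_tsum fun y => ((hm y).const_mul _).aemeasurable]
          exact tsum_congr fun y => lintegral_const_mul _ (hm y)
  rw [← hS, ← ofReal_intervalIntegral hN cG fun t _ => pseudoGrad_nonneg hs hq _ x,
    ← ofReal_intervalIntegral hN cV fun t _ => nV x t, ← ENNReal.ofReal_mul hκ,
    ← ENNReal.ofReal_add, ← ENNReal.ofReal_add]
  · refine ENNReal.ofReal_le_ofReal ?_
    linarith [nV x N]
  · exact Real.rpow_nonneg (abs_nonneg _) _
  · exact intervalIntegral.integral_nonneg hN fun t _ => tsum_nonneg fun y => nK y t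
  · exact intervalIntegral.integral_nonneg hN fun t _ => pseudoGrad_nonneg hs hq _ x
  · exact mul_nonneg hκ (intervalIntegral.integral_nonneg hN fun t _ => nV x t)

theorem tsum_lintegral_Ioc_pseudoGrad_le (hs : s ∈ Set.Ioo (0 : ℝ) 1) (hq : 1 < q)
    (hC : ∀ t, 0 ≤ t → ∀ y, |heat s t f y| ≤ C)
    (hmax : ∑' x, hlMax (fun y => ‖f y‖ₑ) x ^ q ≠ ∞) {N : ℝ} (hN : 0 ≤ N) :
    ∑' x, ∫⁻ t in Set.Ioc 0 N, ENNReal.ofReal (pseudoGrad s q (heat s t f) x) ≤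
      ∑' x, ENNReal.ofReal (|f x| ^ q) := by
  set V : ℤ → ℝ≥0∞ := fun x => ∫⁻ t in Set.Ioc 0 N, ENNReal.ofReal (|heat s t f x| ^ q) with hV
  have hVle : ∀ x, V x ≤ hlMax (fun y => ‖f y‖ₑ) x ^ q * ENNReal.ofReal N := fun x => by
    calc V x ≤ ∫⁻ _ in Set.Ioc 0 N, hlMax (fun y => ‖f y‖ₑ) x ^ q := by
          refine setLIntegral_mono' measurableSet_Ioc fun t ht => ?_
          rw [← ENNReal.ofReal_rpow_of_nonneg (abs_nonneg _) (by linarith), ← Real.norm_eq_abs,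
            ofReal_norm]
          exact ENNReal.rpow_le_rpow (enorm_heat_le_hlMax hs f ht.1.le x) (by linarith)
      _ = _ := by rw [setLIntegral_const, Real.volume_Ioc, sub_zero]
  have hVfin : ∑' x, V x ≠ ∞ := by
    refine ne_top_of_le_ne_top ?_ (ENNReal.tsum_le_tsum hVle)
    rw [ENNReal.tsum_mul_right]
    exact ENNReal.mul_ne_top hmax ENNReal.ofReal_ne_top
  have hswap : ∑' x, ∑' y, ENNReal.ofReal (Ker s (x - y)) * V y =
      ENNReal.ofReal (∑' m, Ker s m) * ∑' y, V y := by
    rw [ENNReal.tsum_comm, ← ENNReal.tsum_mul_left]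
    refine tsum_congr fun y => ?_
    rw [ENNReal.tsum_mul_right, ENNReal.ofReal_tsum_of_nonneg (Ker_nonneg hs) (summable_Ker hs),
      ← (Equiv.subRight y).tsum_eq fun m => ENNReal.ofReal (Ker s m)]
    rfl
  have h := ENNReal.tsum_le_tsum fun x => lintegral_pseudoGrad_add_le hs hq hC x hN
  rw [ENNReal.tsum_add, ENNReal.tsum_add, ENNReal.tsum_mul_left, hswap] at h
  exact ENNReal.le_of_add_le_add_right (ENNReal.mul_ne_top ENNReal.ofReal_ne_top hVfin) h

theorem tsum_lintegral_pseudoGrad_le (hs : s ∈ Set.Ioo (0 : ℝ) 1) (hq : 1 < q)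
    (hC : ∀ t, 0 ≤ t → ∀ y, |heat s t f y| ≤ C)
    (hmax : ∑' x, hlMax (fun y => ‖f y‖ₑ) x ^ q ≠ ∞) :
    ∑' x, ∫⁻ t in Set.Ioi 0, ENNReal.ofReal (pseudoGrad s q (heat s t f) x) ≤
      ∑' x, ENNReal.ofReal (|f x| ^ q) := by
  have hU : Set.Ioi (0 : ℝ) = ⋃ n : ℕ, Set.Ioc 0 (n : ℝ) := by
    ext t
    simp only [Set.mem_Ioi, Set.mem_iUnion, Set.mem_Ioc]
    exact ⟨fun h => (exists_nat_ge t).imp fun n hn => ⟨h, hn⟩, fun ⟨_, h, _⟩ => h⟩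
  have hmono : Monotone fun n : ℕ => Set.Ioc (0 : ℝ) n := fun m n hmn =>
    Set.Ioc_subset_Ioc_right (Nat.cast_le.2 hmn)
  rw [ENNReal.tsum_eq_iSup_sum]
  refine iSup_le fun A => ?_
  simp only [hU, setLIntegral_iUnion_of_directed _ hmono.directed_le]
  rw [ENNReal.finsetSum_iSup_of_monotone fun x m n hmn => lintegral_mono_set (hmono hmn)]
  exact iSup_le fun n => (ENNReal.sum_le_tsum A).trans
    (tsum_lintegral_Ioc_pseudoGrad_le hs hq hC hmax n.cast_nonneg)

end Energy

/-! ### The square function estimate -/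

section SquareFunction

variable {s q : ℝ} {f : ℤ →ᵇ ℝ} {C : ℝ}

theorem ofReal_integral_mgradSq_le (hs : s ∈ Set.Ioo (0 : ℝ) 1) (hq : q ∈ Set.Ioc (1 : ℝ) 2)
    (hC : ∀ t, 0 ≤ t → ∀ y, |heat s t f y| ≤ C) (x : ℤ)
    (hfin : hlMax (fun y => ‖f y‖ₑ) x ≠ ∞) :
    ENNReal.ofReal (∫ t in Set.Ioi (0 : ℝ), mgradSq s (heat s t f) x) ≤
      ENNReal.ofReal (q * (q - 1) / 2)⁻¹ * (hlMax (fun y => ‖f y‖ₑ) x ^ (2 - q) *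
        ∫⁻ t in Set.Ioi 0, ENNReal.ofReal (pseudoGrad s q (heat s t f) x)) := by
  have hc : 0 < q * (q - 1) / 2 := by nlinarith [hq.1]
  have hq2 : 0 ≤ 2 - q := by linarith [hq.2]
  rw [← mul_assoc, ← lintegral_const_mul' _ _ (ENNReal.mul_ne_top ENNReal.ofReal_ne_top
    (ENNReal.rpow_ne_top_of_nonneg hq2 hfin))]
  calc _ ≤ ‖∫ t in Set.Ioi (0 : ℝ), mgradSq s (heat s t f) x‖ₑ := by
        rw [← ofReal_norm]
        exact ENNReal.ofReal_le_ofReal (Real.le_norm_self _)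
    _ ≤ ∫⁻ t in Set.Ioi (0 : ℝ), ‖mgradSq s (heat s t f) x‖ₑ := enorm_integral_le_lintegral_enorm _
    _ ≤ _ := by
        refine setLIntegral_mono' measurableSet_Ioi fun t ht => ?_
        have ht : 0 ≤ t := le_of_lt ht
        have hm : 0 ≤ mgradSq s (heat s t f) x :=
          tsum_nonneg fun y => mul_nonneg (Ker_nonneg hs _) (sq_nonneg _)
        have hle : mgradSq s (heat s t f) x ≤ (q * (q - 1) / 2)⁻¹ *
            (|heat s t f x| ^ (2 - q) * pseudoGrad s q (heat s t f) x) := by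
          rw [inv_mul_eq_div, le_div_iff₀' hc]
          exact mgradSq_le_pseudoGrad hs hq (hC t ht) x
        rw [Real.enorm_of_nonneg hm]
        refine (ENNReal.ofReal_le_ofReal hle).trans ?_
        rw [ENNReal.ofReal_mul (inv_nonneg.2 hc.le),
          ENNReal.ofReal_mul (Real.rpow_nonneg (abs_nonneg _) _),
          ← ENNReal.ofReal_rpow_of_nonneg (abs_nonneg _) hq2, ← Real.norm_eq_abs, ofReal_norm,
          mul_assoc]
        gcongr
        exact enorm_heat_le_hlMax hs f ht x

theorem ENNReal.tsum_rpow_mul_rpow_le {ι : Type*} (a b : ι → ℝ≥0∞) {p r : ℝ} (hp : 0 ≤ p)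
    (hr : 0 ≤ r) (hpr : p + r = 1) :
    ∑' i, a i ^ p * b i ^ r ≤ (∑' i, a i) ^ p * (∑' i, b i) ^ r := by
  let _ : MeasurableSpace ι := ⊤
  have h := ENNReal.lintegral_mul_norm_pow_le (μ := Measure.count) (f := a) (g := b)
    measurable_from_top.aemeasurable measurable_from_top.aemeasurable hp hr hpr
  simpa only [lintegral_count] using h

theorem lqNorm_le_of_tsum_ofReal_le {q D : ℝ} (hq : 0 < q) (hD : 0 ≤ D) {g f : ℤ → ℝ}
    (hf : Summable fun x => |f x| ^ q)
    (h : ∑' x, ENNReal.ofReal (|g x| ^ q) ≤ ENNReal.ofReal D * ∑' x, ENNReal.ofReal (|f x| ^ q)) :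
    lqNorm q g ≤ D ^ (1 / q) * lqNorm q f := by
  have nn : ∀ (g : ℤ → ℝ) x, 0 ≤ |g x| ^ q := fun g x => Real.rpow_nonneg (abs_nonneg _) _
  rw [← ENNReal.ofReal_tsum_of_nonneg (nn f) hf, ← ENNReal.ofReal_mul hD] at h
  have hr : 0 ≤ D * ∑' x, |f x| ^ q := mul_nonneg hD (tsum_nonneg (nn f))
  unfold lqNorm
  rw [← Real.mul_rpow hD (tsum_nonneg (nn f))]
  refine Real.rpow_le_rpow (tsum_nonneg (nn g)) ?_ (by positivity)
  by_cases hg : Summable fun x => |g x| ^ q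
  · rwa [← ENNReal.ofReal_tsum_of_nonneg (nn g) hg, ENNReal.ofReal_le_ofReal_iff hr] at h
  · rwa [tsum_eq_zero_of_not_summable hg]

end SquareFunction

/-- For every `q ∈ (1,2]` there is `c_q > 0` (depending only on `q` and `s`) such that
`‖G̃ f‖_q ≤ c_q ‖f‖_q` for every summable `f`, where
`G̃ f x = (∫₀^∞ |∇̃ (P_t f)|²(x) dt)^{1/2}`. -/
theorem lq_bound_Gtilde (s : ℝ) (hs : s ∈ Set.Ioo (0 : ℝ) 1) (q : ℝ)
    (hq : q ∈ Set.Ioc (1 : ℝ) 2) :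
    ∃ c : ℝ, 0 < c ∧ ∀ f : ℤ → ℝ, Summable f →
      lqNorm q (fun x => Real.sqrt (∫ t in Set.Ioi (0 : ℝ), mgradSq s (heat s t f) x)) ≤
        c * lqNorm q f := by
  have hq1 : 1 < q := hq.1
  have hq0 : 0 < q := by linarith
  have hc : 0 < q * (q - 1) / 2 := by nlinarith
  set A : ℝ := q * (10 * (2 ^ (q - 1) / (q - 1))) with hA
  have hA0 : 0 < A := by
    have := sub_pos.2 hq1
    positivity
  set D : ℝ := ((q * (q - 1) / 2)⁻¹) ^ (q / 2) * A ^ (1 - q / 2) with hD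
  have hD0 : 0 < D := by positivity
  refine ⟨D ^ (1 / q), by positivity, fun f hf => ?_⟩
  have hF : ∑' y, ENNReal.ofReal |f y| ≠ ∞ := hf.abs.tsum_ofReal_ne_top
  have hfbd : ∀ y, ‖f y‖ ≤ ∑' z, |f z| := fun y => hf.abs.le_tsum y fun z _ => abs_nonneg _
  set fB : ℤ →ᵇ ℝ := BoundedContinuousFunction.ofNormedAddCommGroupDiscrete f _ hfbd with hfB
  have hcoe : ⇑fB = f := rfl
  have henorm : (fun y => ‖fB y‖ₑ) = fun y => ENNReal.ofReal |f y| := by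
    ext y
    rw [hcoe, ← ofReal_norm, Real.norm_eq_abs]
  set M : ℤ → ℝ≥0∞ := hlMax fun y => ‖fB y‖ₑ with hM
  have hMle : ∀ x, M x ≤ ∑' y, ENNReal.ofReal |f y| := fun x => by
    rw [hM, henorm]
    exact hlMax_le_tsum _ x
  have hMfin : ∀ x, M x ≠ ∞ := fun x => ne_top_of_le_ne_top hF (hMle x)
  have hfq : Summable fun x => |f x| ^ q := by
    refine Summable.of_nonneg_of_le (fun x => Real.rpow_nonneg (abs_nonneg _) _) (fun x => ?_)
      (hf.abs.mul_left ((∑' z, |f z|) ^ (q - 1)))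
    have e : |f x| ^ q = |f x| ^ (q - 1) * |f x| := by
      rw [← Real.rpow_add_one' (abs_nonneg _) (by linarith), sub_add_cancel]
    rw [e]
    gcongr
    exact hfbd x
  have hMq : ∑' x, M x ^ q ≤ ENNReal.ofReal A * ∑' x, ENNReal.ofReal (|f x| ^ q) := by
    rw [hM, henorm]
    exact tsum_hlMax_rpow_le hq1 hf
  have hMq' : ∑' x, M x ^ q ≠ ∞ := ne_top_of_le_ne_top
    (ENNReal.mul_ne_top ENNReal.ofReal_ne_top hfq.tsum_ofReal_ne_top) hMq
  have hC : ∀ t, 0 ≤ t → ∀ y, |heat s t fB y| ≤ (∑' y, ENNReal.ofReal |f y|).toReal := by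
    intro t ht y
    rw [← Real.norm_eq_abs, ← toReal_enorm]
    exact ENNReal.toReal_mono hF ((enorm_heat_le_hlMax hs fB ht y).trans (hMle y))
  set J : ℤ → ℝ≥0∞ := fun x =>
    ∫⁻ t in Set.Ioi 0, ENNReal.ofReal (pseudoGrad s q (heat s t fB) x) with hJ
  have hJle : ∑' x, J x ≤ ∑' x, ENNReal.ofReal (|f x| ^ q) :=
    tsum_lintegral_pseudoGrad_le hs hq1 hC hMq'
  refine lqNorm_le_of_tsum_ofReal_le hq0 hD0.le hfq ?_
  have hpt : ∀ x, ENNReal.ofReal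
      (|Real.sqrt (∫ t in Set.Ioi (0 : ℝ), mgradSq s (heat s t f) x)| ^ q) ≤
        ENNReal.ofReal ((q * (q - 1) / 2)⁻¹ ^ (q / 2)) *
          ((M x ^ q) ^ (1 - q / 2) * J x ^ (q / 2)) := fun x => by
    set I := ∫ t in Set.Ioi (0 : ℝ), mgradSq s (heat s t f) x with hI
    have h := ENNReal.rpow_le_rpow (ofReal_integral_mgradSq_le hs hq hC x (hMfin x))
      (by positivity : 0 ≤ q / 2)
    have hI0 : 0 ≤ I := setIntegral_nonneg measurableSet_Ioi fun t _ =>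
      tsum_nonneg fun y => mul_nonneg (Ker_nonneg hs _) (sq_nonneg _)
    calc _ = ENNReal.ofReal I ^ (q / 2) := by
          rw [abs_of_nonneg (Real.sqrt_nonneg _), Real.sqrt_eq_rpow, ← Real.rpow_mul hI0,
            ENNReal.ofReal_rpow_of_nonneg hI0 (by positivity)]
          ring_nf
      _ ≤ _ := h
      _ = _ := by
          rw [ENNReal.mul_rpow_of_nonneg _ _ (by positivity),
            ENNReal.mul_rpow_of_nonneg _ _ (by positivity),
            ENNReal.ofReal_rpow_of_nonneg (by positivity) (by positivity), ← ENNReal.rpow_mul,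
            ← ENNReal.rpow_mul]
          congr 3
          ring
  calc _ ≤ ∑' x, ENNReal.ofReal ((q * (q - 1) / 2)⁻¹ ^ (q / 2)) *
          ((M x ^ q) ^ (1 - q / 2) * J x ^ (q / 2)) := ENNReal.tsum_le_tsum hpt
    _ ≤ ENNReal.ofReal ((q * (q - 1) / 2)⁻¹ ^ (q / 2)) *
          ((∑' x, M x ^ q) ^ (1 - q / 2) * (∑' x, J x) ^ (q / 2)) := by
        rw [ENNReal.tsum_mul_left]
        gcongr
        exact ENNReal.tsum_rpow_mul_rpow_le _ _ (by linarith [hq.2]) (by positivity) (by ring)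
    _ ≤ ENNReal.ofReal ((q * (q - 1) / 2)⁻¹ ^ (q / 2)) *
          ((ENNReal.ofReal A * ∑' x, ENNReal.ofReal (|f x| ^ q)) ^ (1 - q / 2) *
            (∑' x, ENNReal.ofReal (|f x| ^ q)) ^ (q / 2)) := by
        have : 0 ≤ 1 - q / 2 := by linarith [hq.2]
        gcongr
    _ = _ := by
        have h1 : 0 ≤ 1 - q / 2 := by linarith [hq.2]
        rw [ENNReal.mul_rpow_of_nonneg _ _ h1, mul_assoc, ← ENNReal.rpow_add_of_nonneg _ _ h1
          (by positivity), sub_add_cancel, ENNReal.rpow_one, ENNReal.ofReal_rpow_of_nonneg hA0.le h1,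
          ← mul_assoc, ← ENNReal.ofReal_mul (by positivity)]
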